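/- Let x ∈ ℝ^N have support T with |T| = K ≥ 1 and let y = Φx. Let S₀ ⊆ {1,…,N} be any support estimate with n_c = |S₀ ∩ T| < K and n_f = |S₀ ∖ T|. If Φ satisfies the restricted isometry property of order K + n_f + 1 with constant δ < 1/(√(K − n_c) + 1), then every OMP trajectory started from S₀ satisfies T ⊆ S_{K−n_c}, the set S_{K−n_c} has exactly K + n_f elements, and every x̃ ∈ ℝ^N supported on S_{K−n_c} satisfying the normal equations ⟨φ_i, y − Φx̃⟩ = 0 for all i ∈ S_{K−n_c} equals x; that is, OMP perfectly recovers x after K − n_c further iterations (a total support size of K + n_f). -/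

import Mathlib

open Finset

/-- The Euclidean (ℓ²) norm of a vector in ℝⁿ. -/
noncomputable def l2norm {n : ℕ} (v : Fin n → ℝ) : ℝ := Real.sqrt (∑ i, v i ^ 2)

/-- The Euclidean inner product on ℝᵐ. -/
noncomputable def dot {m : ℕ} (u v : Fin m → ℝ) : ℝ := ∑ k, u k * v k

/-- `x` has at most `s` nonzero entries. -/
noncomputable def sparse {n : ℕ} (s : ℕ) (x : Fin n → ℝ) : Prop :=
  (Finset.univ.filter (fun i => x i ≠ 0)).card ≤ s

/-- `Φ` satisfies the restricted isometry property of order `s` with constant `δ`. -/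
noncomputable def RIP {M N : ℕ} (Φ : Matrix (Fin M) (Fin N) ℝ) (s : ℕ) (δ : ℝ) : Prop :=
  ∀ x : Fin N → ℝ, sparse s x →
    (1 - δ) * l2norm x ^ 2 ≤ l2norm (Φ.mulVec x) ^ 2 ∧
    l2norm (Φ.mulVec x) ^ 2 ≤ (1 + δ) * l2norm x ^ 2

lemma l2sq {n : ℕ} (v : Fin n → ℝ) : l2norm v ^ 2 = ∑ i, v i ^ 2 := by
  unfold l2norm
  exact Real.sq_sqrt (Finset.sum_nonneg fun i _ => sq_nonneg _)

lemma sq_mulVec {M N : ℕ} (Φ : Matrix (Fin M) (Fin N) ℝ) (z : Fin N → ℝ) :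
    l2norm (Φ.mulVec z) ^ 2 = ∑ i, z i * dot (fun k => Φ k i) (Φ.mulVec z) := by
  rw [l2sq]
  unfold dot
  simp only [Finset.mul_sum]
  rw [Finset.sum_comm]
  refine Finset.sum_congr rfl fun k _ => ?_
  rw [sq]
  conv_lhs => enter [1]; rw [Matrix.mulVec, dotProduct]
  rw [Finset.sum_mul]
  exact Finset.sum_congr rfl fun i _ => by ring

lemma sparse_of_supp {N s : ℕ} (z : Fin N → ℝ) (U : Finset (Fin N))
    (hz : ∀ i, z i ≠ 0 → i ∈ U) (hU : U.card ≤ s) : sparse s z := by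
  refine le_trans (Finset.card_le_card ?_) hU
  intro i hi
  exact hz i (by simpa using hi)

/-- near-orthogonality of a column outside the support -/
lemma col_bound {M N s : ℕ} (Φ : Matrix (Fin M) (Fin N) ℝ) (δ : ℝ) (hR : RIP Φ (s + 1) δ)
    (z : Fin N → ℝ) (U : Finset (Fin N)) (hz : ∀ i, z i ≠ 0 → i ∈ U) (hU : U.card ≤ s)
    (j : Fin N) (hj : j ∉ U) (hpos : 0 < l2norm z) :
    |dot (fun k => Φ k j) (Φ.mulVec z)| ≤ δ * l2norm z := by
  have hzj : z j = 0 := by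
    by_contra h
    exact hj (hz j h)
  have key : ∀ c : ℝ, l2norm (z + Pi.single j c) ^ 2 = l2norm z ^ 2 + c ^ 2 ∧
      l2norm (Φ.mulVec (z + Pi.single j c)) ^ 2 = l2norm (Φ.mulVec z) ^ 2
        + 2 * c * dot (fun k => Φ k j) (Φ.mulVec z) + c ^ 2 * ∑ k, Φ k j ^ 2 ∧
      sparse (s + 1) (z + Pi.single j c) := by
    intro c
    refine ⟨?_, ?_, ?_⟩
    · rw [l2sq, l2sq]
      have : ∀ i, (z + Pi.single j c : Fin N → ℝ) i ^ 2 = z i ^ 2 + (if i = j then c ^ 2 else 0) := by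
        intro i
        by_cases h : i = j
        · subst h; simp [hzj]
        · simp [h]
      simp only [this, Finset.sum_add_distrib]
      simp
    · rw [l2sq, l2sq, Matrix.mulVec_add]
      unfold dot
      rw [Finset.mul_sum, Finset.mul_sum, ← Finset.sum_add_distrib, ← Finset.sum_add_distrib]
      refine Finset.sum_congr rfl fun k _ => ?_
      simp [Matrix.mulVec_single]
      ring
    · refine sparse_of_supp _ (insert j U) ?_ ?_
      · intro i hi
        by_cases h : i = j
        · simp [h]
        · simp only [Pi.add_apply, Pi.single_apply, h, if_false, add_zero] at hi
          exact Finset.mem_insert_of_mem (hz i hi)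
      · rw [Finset.card_insert_of_notMem hj]; omega
  set c := l2norm z with hc
  obtain ⟨a1, a2, a3⟩ := key c
  obtain ⟨b1, b2, b3⟩ := key (-c)
  obtain ⟨p1, p2⟩ := hR _ a3
  obtain ⟨q1, q2⟩ := hR _ b3
  rw [a1, a2] at p1 p2
  rw [b1, b2] at q1 q2
  set d := dot (fun k => Φ k j) (Φ.mulVec z)
  rw [abs_le]
  constructor
  · have : c * (-d) ≤ c * (δ * c) := by nlinarith
    have := le_of_mul_le_mul_left this hpos
    linarith
  · have : c * d ≤ c * (δ * c) := by nlinarith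
    exact le_of_mul_le_mul_left this hpos

lemma omp_step {M N s : ℕ} (Φ : Matrix (Fin M) (Fin N) ℝ) (δ : ℝ) (hδ0 : 0 < δ)
    (hR : RIP Φ (s + 1) δ)
    (z : Fin N → ℝ) (S T : Finset (Fin N)) (hz : ∀ i, z i ≠ 0 → i ∈ T ∪ S)
    (hU : (T ∪ S).card ≤ s) (hne : z ≠ 0)
    (hδ : δ * (Real.sqrt ((T \ S).card) + 1) < 1)
    (horth : ∀ i ∈ S, dot (fun k => Φ k i) (Φ.mulVec z) = 0) (t : Fin N)
    (hmax : ∀ i, |dot (fun k => Φ k i) (Φ.mulVec z)| ≤ |dot (fun k => Φ k t) (Φ.mulVec z)|) :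
    t ∈ T \ S := by
  by_contra ht
  have hsqpos : 0 < l2norm z ^ 2 := by
    rw [l2sq]
    obtain ⟨i, hi⟩ := Function.ne_iff.mp hne
    have hi : z i ≠ 0 := hi
    exact Finset.sum_pos' (fun i _ => sq_nonneg _) ⟨i, Finset.mem_univ _, by positivity⟩
  have hpos : 0 < l2norm z := by
    have h0 : 0 ≤ l2norm z := Real.sqrt_nonneg _
    exact lt_of_le_of_ne h0 fun h => by rw [← h] at hsqpos; simp at hsqpos
  have hμ : |dot (fun k => Φ k t) (Φ.mulVec z)| ≤ δ * l2norm z := by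
    by_cases htS : t ∈ S
    · rw [horth t htS, abs_zero]; positivity
    · refine col_bound Φ δ hR z _ hz hU t ?_ hpos
      simp only [Finset.mem_union, Finset.mem_sdiff] at ht ⊢
      tauto
  have h1 := (hR z (sparse_of_supp z _ hz (hU.trans (Nat.le_succ s)))).1
  rw [sq_mulVec] at h1
  have h2 : ∑ i, z i * dot (fun k => Φ k i) (Φ.mulVec z)
      = ∑ i ∈ T \ S, z i * dot (fun k => Φ k i) (Φ.mulVec z) := by
    symm
    refine Finset.sum_subset (Finset.subset_univ _) ?_
    intro i _ hi
    by_cases hS : i ∈ S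
    · rw [horth i hS, mul_zero]
    · have : z i = 0 := by
        by_contra h
        have := hz i h
        simp only [Finset.mem_union, Finset.mem_sdiff] at this hi
        tauto
      rw [this, zero_mul]
  have h3 : ∑ i ∈ T \ S, z i * dot (fun k => Φ k i) (Φ.mulVec z)
      ≤ (∑ i ∈ T \ S, |z i|) * (δ * l2norm z) := by
    rw [Finset.sum_mul]
    refine Finset.sum_le_sum fun i _ => ?_
    calc _ ≤ |z i * dot (fun k => Φ k i) (Φ.mulVec z)| := le_abs_self _
      _ = |z i| * |dot (fun k => Φ k i) (Φ.mulVec z)| := abs_mul _ _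
      _ ≤ _ := mul_le_mul_of_nonneg_left ((hmax i).trans hμ) (abs_nonneg _)
  have h4 : ∑ i ∈ T \ S, |z i| ≤ Real.sqrt ((T \ S).card) * l2norm z := by
    refine abs_le_of_sq_le_sq' ?_ (by positivity) |>.2
    rw [mul_pow, Real.sq_sqrt (Nat.cast_nonneg _), l2sq]
    refine sq_sum_le_card_mul_sum_sq.trans ?_
    refine mul_le_mul_of_nonneg_left ?_ (Nat.cast_nonneg _)
    simp only [sq_abs]
    exact Finset.sum_le_sum_of_subset_of_nonneg (Finset.subset_univ _) fun i _ _ => sq_nonneg _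
  have h5 := mul_le_mul_of_nonneg_right h4 (by positivity : 0 ≤ δ * l2norm z)
  have h6 : (δ * (Real.sqrt ((T \ S).card) + 1)) * l2norm z ^ 2 < 1 * l2norm z ^ 2 :=
    mul_lt_mul_of_pos_right hδ hsqpos
  nlinarith

/-- Theorem 3, online recovery guarantee for OMP:
let `x` be `K`-sparse with support `T` (`K ≥ 1`), `y = Φx`, and let `S 0` be any support
estimate with `n_c = |S 0 ∩ T| < K` and `n_f = |S 0 ∖ T|`.  If `Φ` has RIP of order
`K + n_f + 1` with constant `δ < 1/(√(K−n_c)+1)`, then every OMP trajectory started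
from `S 0` satisfies `T ⊆ S (K − n_c)`, `|S (K − n_c)| = K + n_f`, and the
least-squares solution of `y` on `S (K − n_c)` is exactly `x`. -/
theorem stmt_12 {M N : ℕ} (K : ℕ) (hK : 1 ≤ K)
    (Φ : Matrix (Fin M) (Fin N) ℝ)
    (x : Fin N → ℝ) (T : Finset (Fin N))
    (hT : ∀ i, x i ≠ 0 ↔ i ∈ T) (hTcard : T.card = K)
    (y : Fin M → ℝ) (hy : y = Φ.mulVec x)
    (S : ℕ → Finset (Fin N)) (t : ℕ → Fin N) (xt : ℕ → Fin N → ℝ)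
    (nc nf : ℕ) (hnc : nc = (S 0 ∩ T).card) (hnf : nf = (S 0 \ T).card)
    (hncK : nc < K)
    (δ : ℝ) (hδ0 : 0 < δ)
    (hδ : δ < 1 / (Real.sqrt ((K : ℝ) - (nc : ℝ)) + 1))
    (hRIP : RIP Φ (K + nf + 1) δ)
    (hsupp : ∀ m < K - nc, ∀ i, xt m i ≠ 0 → i ∈ S m)
    (horth : ∀ m < K - nc, ∀ i ∈ S m, dot (fun k => Φ k i) (y - Φ.mulVec (xt m)) = 0)
    (hmax : ∀ m < K - nc, ∀ i : Fin N,
      |dot (fun k => Φ k i) (y - Φ.mulVec (xt m))| ≤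
        |dot (fun k => Φ k (t m)) (y - Φ.mulVec (xt m))|)
    (hstep : ∀ m < K - nc, S (m + 1) = insert (t m) (S m)) :
    T ⊆ S (K - nc) ∧
    (S (K - nc)).card = K + nf ∧
    ∀ w : Fin N → ℝ, (∀ i, w i ≠ 0 → i ∈ S (K - nc)) →
      (∀ i ∈ S (K - nc), dot (fun k => Φ k i) (y - Φ.mulVec w) = 0) → w = x := by
  have hk : (0 : ℝ) ≤ Real.sqrt ((K : ℝ) - (nc : ℝ)) := Real.sqrt_nonneg _
  have hδ' : δ * (Real.sqrt ((K : ℝ) - (nc : ℝ)) + 1) < 1 := by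
    rwa [lt_div_iff₀ (by positivity)] at hδ
  have hδ1 : δ < 1 := by nlinarith [mul_nonneg hδ0.le hk]
  have inv : ∀ m, m ≤ K - nc → (S m \ T).card = nf ∧ (S m ∩ T).card = nc + m := by
    intro m
    induction m with
    | zero => intro _; exact ⟨hnf.symm, hnc.symm⟩
    | succ m ih =>
      intro hm
      have hm' : m < K - nc := hm
      obtain ⟨i1, i2⟩ := ih hm'.le
      have hTS : (T \ S m).card + (nc + m) = K := by
        rw [← i2, ← hTcard, Finset.inter_comm]
        exact Finset.card_sdiff_add_card_inter T (S m)
      have hres : y - Φ.mulVec (xt m) = Φ.mulVec (x - xt m) := by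
        rw [hy, Matrix.mulVec_sub]
      have hmem : t m ∈ T \ S m := by
        refine omp_step Φ δ hδ0 hRIP (x - xt m) (S m) T ?_ ?_ ?_ ?_ ?_ (t m) ?_
        · intro i hi
          by_contra h
          simp only [Finset.mem_union, not_or] at h
          have e1 : x i = 0 := by
            by_contra h'
            exact h.1 ((hT i).1 h')
          have e2 : xt m i = 0 := by
            by_contra h'
            exact h.2 (hsupp m hm' i h')
          exact hi (by simp [e1, e2])
        · rw [← Finset.sdiff_union_self_eq_union, Finset.card_union_of_disjoint Finset.sdiff_disjoint,
            ← Finset.card_sdiff_add_card_inter (S m) T]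
          omega
        · intro h
          have : 0 < (T \ S m).card := by omega
          obtain ⟨i, hi⟩ := Finset.card_pos.1 this
          rw [Finset.mem_sdiff] at hi
          have hx : x i ≠ 0 := (hT i).2 hi.1
          have e2 : xt m i = 0 := by
            by_contra h'
            exact hi.2 (hsupp m hm' i h')
          have := congrFun h i
          simp [e2] at this
          exact hx this
        · refine lt_of_le_of_lt ?_ hδ'
          have : ((T \ S m).card : ℝ) ≤ (K : ℝ) - nc := by
            have : ((T \ S m).card : ℝ) + (nc + m) = K := by exact_mod_cast hTS
            have : (0 : ℝ) ≤ m := Nat.cast_nonneg _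
            linarith
          have := Real.sqrt_le_sqrt this
          gcongr
        · rw [← hres]; exact horth m hm'
        · rw [← hres]; exact hmax m hm'
      rw [Finset.mem_sdiff] at hmem
      rw [hstep m hm', Finset.insert_sdiff_of_mem _ hmem.1, Finset.insert_inter_of_mem hmem.1,
        Finset.card_insert_of_notMem (fun h => hmem.2 (Finset.mem_inter.1 h).1)]
      exact ⟨i1, by omega⟩
  obtain ⟨f1, f2⟩ := inv _ le_rfl
  have hTsub : T ⊆ S (K - nc) := by
    have : S (K - nc) ∩ T = T := Finset.eq_of_subset_of_card_le Finset.inter_subset_right (by omega)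
    rw [← this]
    exact Finset.inter_subset_left
  have hcard : (S (K - nc)).card = K + nf := by
    have := Finset.card_sdiff_add_card_inter (S (K - nc)) T
    omega
  refine ⟨hTsub, hcard, ?_⟩
  intro w hw ho
  have hz : ∀ i, (x - w) i ≠ 0 → i ∈ S (K - nc) := by
    intro i hi
    by_cases h : w i = 0
    · refine hTsub ((hT i).1 ?_)
      simpa [h] using hi
    · exact hw i h
  have hres : y - Φ.mulVec w = Φ.mulVec (x - w) := by
    rw [hy, Matrix.mulVec_sub]
  rw [hres] at ho
  have h1 := (hRIP (x - w) (sparse_of_supp _ _ hz (by omega))).1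
  rw [sq_mulVec, Finset.sum_eq_zero] at h1
  · have h2 : l2norm (x - w) ^ 2 ≤ 0 := by
      by_contra h
      push Not at h
      nlinarith [mul_pos (sub_pos.2 hδ1) h]
    rw [l2sq] at h2
    have h3 := le_antisymm h2 (Finset.sum_nonneg fun i _ => sq_nonneg _)
    rw [Finset.sum_eq_zero_iff_of_nonneg (fun i _ => sq_nonneg _)] at h3
    funext i
    have := h3 i (Finset.mem_univ i)
    have := pow_eq_zero_iff (two_ne_zero) |>.1 this
    simp only [Pi.sub_apply] at this
    linarith
  · intro i _
    by_cases h : (x - w) i = 0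
    · rw [h, zero_mul]
    · rw [ho i (hz i h), mul_zero]
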